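/- Let X be the Cantor space over a finite alphabet 𝒜, T : X → X a computable map, λ a computable Borel probability measure on X, and A ⊆ X a closed set which is a statistical attractor of T with respect to λ. Then A is a Σ₂ closed set, i.e. its inner collection {w : [w] ∩ A ≠ ∅} is a Σ₂ set of words. -/

import Mathlib

open Filter Topology MeasureTheory Set
open scoped ENNReal NNReal

/-- Cylinder of a finite word in Cantor space: the set of sequences beginning with `w`. -/
def cyl {𝒜 : Type*} (w : List 𝒜) : Set (ℕ → 𝒜) :=
  {x | ∀ i : Fin w.length, x i = w.get i}

/-- The shift map on Cantor space. -/
def shiftMap {𝒜 : Type*} (x : ℕ → 𝒜) : ℕ → 𝒜 := fun i => x (i + 1)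

/-- ω-limit set of `x` under iteration of `T`: the set of accumulation points of the orbit. -/
def omegaSet {X : Type*} [TopologicalSpace X] (T : X → X) (x : X) : Set X :=
  {y | MapClusterPt y Filter.atTop fun n => T^[n] x}

/-- Realm of attraction `ρ(A) = {x : ω(x) ⊆ A}`. -/
def realm {X : Type*} [TopologicalSpace X] (T : X → X) (A : Set X) : Set X :=
  {x | omegaSet T x ⊆ A}

/-- `A` is a topological attractor of `T`: a closed invariant set whose realm of attraction is
residual, and such that no strictly smaller closed subset has nonmeager realm of attraction. -/
def IsTopAttractor {X : Type*} [TopologicalSpace X] (T : X → X) (A : Set X) : Prop :=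
  IsClosed A ∧ Set.MapsTo T A A ∧ realm T A ∈ residual X ∧
    ∀ A' : Set X, IsClosed A' → A' ⊂ A → IsMeagre (realm T A')

/-- `A` is a metric attractor of `T` w.r.t. `lam`: a closed invariant set whose realm of
attraction has full measure, and no strictly smaller closed subset has realm of positive
measure. -/
def IsMetricAttractor {X : Type*} [TopologicalSpace X] [MeasurableSpace X]
    (T : X → X) (lam : Measure X) (A : Set X) : Prop :=
  IsClosed A ∧ Set.MapsTo T A A ∧ lam (realm T A) = 1 ∧
    ∀ A' : Set X, IsClosed A' → A' ⊂ A → lam (realm T A') = 0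

/-- Empirical (Birkhoff) measures `ν_n(x) = (1/n) ∑_{i<n} δ_{T^i x}`. -/
noncomputable def empMeasure {X : Type*} [MeasurableSpace X] (T : X → X) (x : X) (n : ℕ) :
    Measure X :=
  (n : ℝ≥0∞)⁻¹ • ∑ i ∈ Finset.range n, Measure.dirac (T^[i] x)

/-- Weak-* convergence of a sequence of measures: integrals of continuous functions converge. -/
def WeakTendsto {X : Type*} [TopologicalSpace X] [MeasurableSpace X]
    (μs : ℕ → Measure X) (μ : Measure X) : Prop :=
  ∀ φ : C(X, ℝ), Filter.Tendsto (fun n => ∫ x, φ x ∂(μs n)) Filter.atTop (nhds (∫ x, φ x ∂μ))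

/-- Topological support of a measure: points all of whose open neighbourhoods have positive
measure. -/
def measSupport {X : Type*} [TopologicalSpace X] [MeasurableSpace X]
    (μ : Measure X) : Set X :=
  {x | ∀ U : Set X, IsOpen U → x ∈ U → 0 < μ U}

/-- `A` is a statistical (physical) attractor of `T` w.r.t. `lam`: there is a `T`-invariant
probability measure `μ` with support `A` such that for `lam`-a.e. `x` the empirical measures
converge weak-* to `μ`. -/
def IsStatAttractor {X : Type*} [TopologicalSpace X] [MeasurableSpace X]
    (T : X → X) (lam : Measure X) (A : Set X) : Prop :=
  IsClosed A ∧ ∃ μ : Measure X, IsProbabilityMeasure μ ∧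
    Measure.map T μ = μ ∧ measSupport μ = A ∧
    ∀ᵐ x ∂lam, WeakTendsto (empMeasure T x) μ

/-- `A` is strongly attracting: there is an open `U ⊇ A` with `T (closure U) ⊆ U` and
`A = ⋂ₙ Tⁿ(U)`. -/
def StronglyAttracting {X : Type*} [TopologicalSpace X] (T : X → X) (A : Set X) : Prop :=
  ∃ U : Set X, IsOpen U ∧ A ⊆ U ∧ T '' (closure U) ⊆ U ∧ A = ⋂ n : ℕ, T^[n] '' U

/-- `S` is Σ₁ (recursively enumerable). -/
def SigmaOne {I : Type*} [Primcodable I] (S : Set I) : Prop :=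
  ∃ f : I × ℕ → Bool, Computable f ∧ ∀ i, i ∈ S ↔ ∃ a, f (i, a) = true

/-- `S` is Π₁ (co-r.e.). -/
def PiOne {I : Type*} [Primcodable I] (S : Set I) : Prop := SigmaOne Sᶜ

/-- `S` is Σ₂. -/
def SigmaTwo {I : Type*} [Primcodable I] (S : Set I) : Prop :=
  ∃ f : I × ℕ × ℕ → Bool, Computable f ∧ ∀ i, i ∈ S ↔ ∃ a, ∀ b, f (i, a, b) = true

/-- `S` is Π₂. -/
def PiTwo {I : Type*} [Primcodable I] (S : Set I) : Prop :=
  ∃ f : I × ℕ × ℕ → Bool, Computable f ∧ ∀ i, i ∈ S ↔ ∀ a, ∃ b, f (i, a, b) = true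

/-- A map of Cantor space is computable if `(T x) n` is computed by a computable function from
`n` and the finite prefix `[x 0, …, x (α n)]` of `x`, for a computable modulus `α`. -/
def CantorComputable {𝒜 : Type} [Primcodable 𝒜] (T : (ℕ → 𝒜) → (ℕ → 𝒜)) : Prop :=
  ∃ (α : ℕ → ℕ) (β : ℕ → List 𝒜 → 𝒜), Computable α ∧ Computable₂ β ∧
    ∀ (x : ℕ → 𝒜) (n : ℕ), T x n = β n (List.ofFn fun i : Fin (α n + 1) => x i)

/-- A Borel probability measure on Cantor space is computable if the measures of finite unions
of cylinders are uniformly lower-computable: `lam(⋃_{w ∈ W} [w]) = sup_k q (W, k)` for a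
computable `q`. -/
def ComputableCantorMeasure {𝒜 : Type} [Primcodable 𝒜] [MeasurableSpace 𝒜]
    (lam : Measure (ℕ → 𝒜)) : Prop :=
  ∃ q : List (List 𝒜) × ℕ → ℚ, Computable q ∧
    ∀ W : List (List 𝒜), (lam (⋃ w ∈ W, cyl w)).toReal = ⨆ k, (q (W, k) : ℝ)

/-- Indices of machines halting on input 0. -/
def HaltSet : Set ℕ := {e | ((Denumerable.ofNat Nat.Partrec.Code e).eval 0).Dom}

/-- Indices of total machines. -/
def TotSet : Set ℕ := {e | ∀ n, ((Denumerable.ofNat Nat.Partrec.Code e).eval n).Dom}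

/-- Indices of machines with finite domain. -/
def FinSet : Set ℕ := {e | {n | ((Denumerable.ofNat Nat.Partrec.Code e).eval n).Dom}.Finite}

namespace Rat

open Encodable Denumerable

lemma coprime_iff_forall_lt (a d : ℕ) :
    a.Coprime d ↔ ∀ k < a + d + 1, ¬ (a % k = 0 ∧ d % k = 0 ∧ k ≠ 1) := by
  constructor
  · rintro h k - ⟨ha, hd, hk⟩
    exact hk (Nat.eq_one_of_dvd_coprimes h (Nat.dvd_of_mod_eq_zero ha) (Nat.dvd_of_mod_eq_zero hd))
  · intro h
    by_contra hg
    refine h (a.gcd d) ?_ ⟨Nat.mod_eq_zero_of_dvd (Nat.gcd_dvd_left a d),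
      Nat.mod_eq_zero_of_dvd (Nat.gcd_dvd_right a d), hg⟩
    rcases Nat.eq_zero_or_pos a with rfl | ha
    · simp
    · have := Nat.gcd_le_left d ha
      omega

lemma primrecRel_coprime : PrimrecRel Nat.Coprime := by
  have hR : PrimrecRel fun (k n : ℕ) =>
      ¬ (n.unpair.1 % k = 0 ∧ n.unpair.2 % k = 0 ∧ k ≠ 1) := by
    have hk : Primrec fun p : ℕ × ℕ => p.1 := Primrec.fst
    have hn : Primrec fun p : ℕ × ℕ => p.2.unpair := Primrec.unpair.comp Primrec.snd
    have h1 : PrimrecPred fun p : ℕ × ℕ => p.2.unpair.1 % p.1 = 0 :=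
      Primrec.eq.comp (Primrec.nat_mod.comp (Primrec.fst.comp hn) hk) (Primrec.const 0)
    have h2 : PrimrecPred fun p : ℕ × ℕ => p.2.unpair.2 % p.1 = 0 :=
      Primrec.eq.comp (Primrec.nat_mod.comp (Primrec.snd.comp hn) hk) (Primrec.const 0)
    have h3 : PrimrecPred fun p : ℕ × ℕ => p.1 = 1 := Primrec.eq.comp hk (Primrec.const 1)
    exact (h1.and (h2.and h3.not)).not
  have hb : Primrec fun p : ℕ × ℕ => p.1 + p.2 + 1 :=
    Primrec.succ.comp (Primrec.nat_add.comp Primrec.fst Primrec.snd)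
  have := (PrimrecRel.forall_lt hR).comp hb (Primrec₂.natPair.comp Primrec.fst Primrec.snd)
  refine PrimrecPred.of_eq this fun p => ?_
  simp only [Nat.unpair_pair]
  exact (coprime_iff_forall_lt _ _).symm

/-- The code of a rational number as a numerator-denominator pair. -/
def fractionCode (r : ℚ) : ℕ := Nat.pair (encode r.num) r.den

lemma encode_int_of_nonneg {z : ℤ} (hz : 0 ≤ z) : encode z = 2 * z.toNat := by
  obtain ⟨n, rfl⟩ := Int.eq_ofNat_of_zero_le hz
  rfl

lemma encode_int_of_neg {z : ℤ} (hz : z < 0) : encode z = 2 * (-z).toNat - 1 := by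
  obtain ⟨n, rfl⟩ := Int.eq_negSucc_of_lt_zero hz
  change 2 * n + 1 = 2 * (n + 1) - 1
  omega

lemma natAbs_eq_of_encode (z : ℤ) : z.natAbs = (encode z + 1) / 2 := by
  rcases lt_or_ge z 0 with h | h
  · rw [encode_int_of_neg h]; omega
  · rw [encode_int_of_nonneg h]; omega

lemma mem_range_fractionCode (m : ℕ) : m ∈ Set.range fractionCode ↔
    0 < m.unpair.2 ∧ ((m.unpair.1 + 1) / 2).Coprime m.unpair.2 := by
  constructor
  · rintro ⟨r, rfl⟩
    simp only [fractionCode, Nat.unpair_pair, ← natAbs_eq_of_encode]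
    exact ⟨r.den_pos, r.reduced⟩
  · rintro ⟨h1, h2⟩
    have he : encode (ofNat ℤ m.unpair.1) = m.unpair.1 := encode_ofNat _
    refine ⟨⟨ofNat ℤ m.unpair.1, m.unpair.2, h1.ne', ?_⟩, ?_⟩
    · rwa [natAbs_eq_of_encode, he]
    · simp only [fractionCode, he, Nat.pair_unpair]

lemma primrecPred_range_fractionCode : PrimrecPred (· ∈ Set.range fractionCode) := by
  have h1 : PrimrecPred fun m : ℕ => 0 < m.unpair.2 :=
    Primrec.nat_lt.comp (Primrec.const 0) (Primrec.snd.comp Primrec.unpair)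
  have h2 : PrimrecPred fun m : ℕ => ((m.unpair.1 + 1) / 2).Coprime m.unpair.2 :=
    primrecRel_coprime.comp
      (Primrec.nat_div.comp (Primrec.succ.comp (Primrec.fst.comp Primrec.unpair))
        (Primrec.const 2)) (Primrec.snd.comp Primrec.unpair)
  exact (h1.and h2).of_eq fun m => (mem_range_fractionCode m).symm

open Classical in
lemma encode_eq_length_filter (r : ℚ) : @encode ℚ Primcodable.toEncodable r =
    ((List.range (fractionCode r)).filter (· ∈ Set.range fractionCode)).length := by
  rw [← List.countP_eq_length_filter]
  have : @encode ℚ Primcodable.toEncodable r = (List.range (fractionCode r)).countP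
      fun m => @decide (m ∈ Set.range fractionCode) (@decidableRangeEncode ℚ instEncodable m) := rfl
  rw [this]
  congr! 2
  exact decide_eq_decide.2 Iff.rfl

open Classical in
lemma computable_fractionCode : Computable fractionCode := by
  have hs := primrecPred_range_fractionCode
  have hp : PrimrecPred fun p : ℚ × ℕ => p.2 ∈ Set.range fractionCode ∧
      @encode ℚ Primcodable.toEncodable p.1 =
        ((List.range p.2).filter (· ∈ Set.range fractionCode)).length :=
    (hs.comp Primrec.snd).and (Primrec.eq.comp (Primrec.encode.comp Primrec.fst)
      (Primrec.list_length.comp ((Primrec.listFilter hs).comp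
        (Primrec.list_range.comp Primrec.snd))))
  have hd : Computable₂ fun (r : ℚ) (m : ℕ) => decide (m ∈ Set.range fractionCode ∧
      @encode ℚ Primcodable.toEncodable r =
        ((List.range m).filter (· ∈ Set.range fractionCode)).length) :=
    hp.decide.to_comp
  refine (Partrec.rfind hd.partrec₂).of_eq fun r => Part.eq_some_iff.2 ?_
  rw [Nat.mem_rfind]
  constructor
  · exact Part.mem_some_iff.2 (Eq.symm (decide_eq_true ⟨⟨r, rfl⟩, encode_eq_length_filter r⟩))
  · intro m hm
    refine Part.mem_some_iff.2 (Eq.symm (decide_eq_false ?_))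
    rintro ⟨⟨s, rfl⟩, h⟩
    rw [← encode_eq_length_filter] at h
    rw [@encode_injective ℚ Primcodable.toEncodable _ _ h] at hm
    exact hm.false

lemma natCast_lt_natCast_mul_iff (a b : ℕ) (r : ℚ) : (a : ℚ) < b * r ↔
    (fractionCode r).unpair.1 % 2 = 0 ∧
      a * (fractionCode r).unpair.2 < b * ((fractionCode r).unpair.1 / 2) := by
  have hd : (0 : ℚ) < r.den := mod_cast r.den_pos
  have key : (a : ℚ) < b * r ↔ (a : ℤ) * r.den < b * r.num := by
    conv_lhs => rw [← Rat.num_div_den r, ← mul_div_assoc, lt_div_iff₀ hd]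
    exact_mod_cast Iff.rfl
  rw [key]
  simp only [fractionCode, Nat.unpair_pair]
  rcases lt_or_ge r.num 0 with h | h
  · rw [encode_int_of_neg h]
    have h1 : (0 : ℤ) ≤ a * r.den := by positivity
    have h2 : (b : ℤ) * r.num ≤ 0 := mul_nonpos_of_nonneg_of_nonpos (by positivity) h.le
    omega
  · rw [encode_int_of_nonneg h, Nat.mul_div_cancel_left _ two_pos]
    zify
    simp [h]

lemma computable_natCast_lt_natCast_mul (a b : ℕ) :
    Computable fun r : ℚ => decide ((a : ℚ) < b * r) := by
  have h : PrimrecPred fun m : ℕ =>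
      m.unpair.1 % 2 = 0 ∧ a * m.unpair.2 < b * (m.unpair.1 / 2) :=
    (Primrec.eq.comp (Primrec.nat_mod.comp (Primrec.fst.comp Primrec.unpair) (Primrec.const 2))
      (Primrec.const 0)).and
    (Primrec.nat_lt.comp
      (Primrec.nat_mul.comp (Primrec.const a) (Primrec.snd.comp Primrec.unpair))
      (Primrec.nat_mul.comp (Primrec.const b)
        (Primrec.nat_div.comp (Primrec.fst.comp Primrec.unpair) (Primrec.const 2))))
  exact (h.decide.to_comp.comp computable_fractionCode).of_eq fun r =>
    decide_eq_decide.2 (natCast_lt_natCast_mul_iff a b r).symm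

end Rat

/-- Union of the cylinders of the words in a list. -/
def cylUnion {𝒜 : Type*} (W : List (List 𝒜)) : Set (ℕ → 𝒜) := ⋃ w ∈ W, cyl w

lemma cylUnion_append {𝒜 : Type*} (V W : List (List 𝒜)) :
    cylUnion (V ++ W) = cylUnion V ∪ cylUnion W := by
  ext x
  simp only [cylUnion, List.mem_append, mem_iUnion, mem_union, exists_prop, or_and_right,
    exists_or]

lemma exists_one_lt_mul_of_half_lt {u : ℕ → ℚ} (h : 1 / 2 < ⨆ k, (u k : ℝ)) :
    ∃ k, ((1 : ℕ) : ℚ) < (2 : ℕ) * u k := by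
  obtain ⟨k, hk⟩ := exists_lt_of_lt_ciSup h
  refine ⟨k, ?_⟩
  have : (1 : ℝ) < 2 * u k := by linarith
  exact_mod_cast this

lemma iSup_eq_zero_of_one_lt {u : ℕ → ℚ} (hu : ⨆ k, (u k : ℝ) ≤ 1) {k : ℕ}
    (h : ((1 : ℕ) : ℚ) < (1 : ℕ) * u k) : ⨆ k, (u k : ℝ) = 0 := by
  refine Real.iSup_of_not_bddAbove fun hb => ?_
  have h1 := (le_ciSup hb k).trans hu
  have h2 : (1 : ℝ) < u k := by exact_mod_cast (by simpa using h : (1 : ℚ) < u k)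
  exact h1.not_gt h2

lemma iSup_eq_zero_of_one_lt_two_mul {u : ℕ → ℚ} (hu : ⨆ k, (u k : ℝ) ≤ 1 / 2) {k : ℕ}
    (h : ((1 : ℕ) : ℚ) < (2 : ℕ) * u k) :
    ⨆ k, (u k : ℝ) = 0 ∧ ∃ j, ((1 : ℕ) : ℚ) < (1 : ℕ) * u j := by
  have hb : ¬ BddAbove (range fun k => (u k : ℝ)) := by
    intro hb
    have h1 := (le_ciSup hb k).trans hu
    have h2 : (1 : ℝ) < 2 * u k := by exact_mod_cast h
    linarith
  refine ⟨Real.iSup_of_not_bddAbove hb, ?_⟩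
  by_contra! hj
  refine hb ⟨1, ?_⟩
  rintro - ⟨j, rfl⟩
  have := hj j
  simp only [Nat.cast_one, one_mul] at this
  change (u j : ℝ) ≤ 1
  exact_mod_cast this

lemma sigmaOne_exists_exists_and_exists {σ τ : Type*} [Primcodable σ] [Primcodable τ]
    {q : σ × ℕ → τ} (hq : Computable q) {g : τ → Bool} (hg : Computable g)
    {I : Type*} [Primcodable I] {F G : I × ℕ → σ} (hF : Computable F) (hG : Computable G) :
    SigmaOne {i | ∃ n, (∃ k, g (q (F (i, n), k)) = true) ∧ ∃ k, g (q (G (i, n), k)) = true} := by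
  have key : ∀ {H : I × ℕ → σ}, Computable H →
      Computable fun p : (I × ℕ) × ℕ => g (q (H p.1, p.2)) := fun hH =>
    hg.comp (hq.comp ((hH.comp Computable.fst).pair Computable.snd))
  have hu : Computable Nat.unpair := Primrec.unpair.to_comp
  have h2 : Computable fun p : I × ℕ => p.2.unpair := hu.comp Computable.snd
  have h3 : Computable fun p : I × ℕ => p.2.unpair.2.unpair := hu.comp (Computable.snd.comp h2)
  have hin : Computable fun p : I × ℕ => (p.1, p.2.unpair.1) :=
    Computable.fst.pair (Computable.fst.comp h2)
  refine ⟨fun p => g (q (F (p.1, p.2.unpair.1), p.2.unpair.2.unpair.1)) &&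
      g (q (G (p.1, p.2.unpair.1), p.2.unpair.2.unpair.2)),
    Primrec.and.to_comp.comp ((key hF).comp (hin.pair (Computable.fst.comp h3)))
      ((key hG).comp (hin.pair (Computable.snd.comp h3))), fun i => ?_⟩
  simp only [mem_ofPred_eq, Bool.and_eq_true]
  constructor
  · rintro ⟨n, ⟨k, hk⟩, l, hl⟩
    refine ⟨Nat.pair n (Nat.pair k l), ?_⟩
    simp only [Nat.unpair_pair]
    exact ⟨hk, hl⟩
  · rintro ⟨a, h1, h2⟩
    exact ⟨_, ⟨_, h1⟩, _, h2⟩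

lemma sigmaOne_exists_one_lt_mul {𝒜 : Type} [Primcodable 𝒜] {q : List (List 𝒜) × ℕ → ℚ}
    (hq : Computable q) (b : ℕ) {I : Type*} [Primcodable I] {F G : I × ℕ → List (List 𝒜)}
    (hF : Computable F) (hG : Computable G) :
    SigmaOne {i | ∃ n, (∃ k, ((1 : ℕ) : ℚ) < b * q (F (i, n), k)) ∧
      ∃ k, ((1 : ℕ) : ℚ) < b * q (G (i, n), k)} := by
  have := sigmaOne_exists_exists_and_exists hq
    (Rat.computable_natCast_lt_natCast_mul 1 b) hF hG
  simpa only [decide_eq_true_eq] using this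

/-- Lists of cylinders whose union has measure more than one half can be enumerated, provided the
complements are computable too. The function `q` may be unbounded on null unions, where the
supremum takes the junk value zero. -/
theorem sigmaOne_half_lt_measure {𝒜 : Type} [Primcodable 𝒜] [MeasurableSpace 𝒜]
    {lam : Measure (ℕ → 𝒜)} [IsProbabilityMeasure lam] (hlam : ComputableCantorMeasure lam)
    {I : Type*} [Primcodable I] {V V' : I → List (List 𝒜)} (hV : Computable V)
    (hV' : Computable V') (hmeas : ∀ i, MeasurableSet (cylUnion (V i)))
    (hcompl : ∀ i, cylUnion (V' i) = (cylUnion (V i))ᶜ) :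
    SigmaOne {i | 1 / 2 < lam.real (cylUnion (V i))} := by
  obtain ⟨q, hqc, hq⟩ := hlam
  replace hq : ∀ W, lam.real (cylUnion W) = ⨆ k, (q (W, k) : ℝ) := hq
  have hle : ∀ W, ⨆ k, (q (W, k) : ℝ) ≤ 1 := fun W => hq W ▸ measureReal_le_one
  have hadd : ∀ i, lam.real (cylUnion (V' i)) = 1 - lam.real (cylUnion (V i)) := fun i => by
    rw [hcompl, probReal_compl_eq_one_sub (hmeas i)]
  have hunion : ∀ W i, lam.real (cylUnion W) = 0 →
      lam.real (cylUnion (W ++ V' i)) = lam.real (cylUnion (V' i)) := fun W i hW => by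
    rw [cylUnion_append]
    refine le_antisymm ((measureReal_union_le _ _).trans_eq (by rw [hW, zero_add])) ?_
    exact measureReal_mono subset_union_right
  by_cases h : ∃ i₀, ∀ W, lam.real (cylUnion W) = 0 →
      ¬ ((∃ k, ((1 : ℕ) : ℚ) < (2 : ℕ) * q (W, k)) ∧
        ∃ k, ((1 : ℕ) : ℚ) < (2 : ℕ) * q (W ++ V' i₀, k))
  · obtain ⟨i₀, hi₀⟩ := h
    have hF : Computable fun p : I × ℕ => V p.1 := hV.comp Computable.fst
    have hG : Computable fun p : I × ℕ => V p.1 ++ V' i₀ :=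
      Computable.list_append.comp hF (Computable.const _)
    convert sigmaOne_exists_one_lt_mul hqc 2 hF hG using 3 with i
    constructor
    · intro hi
      refine ⟨0, exists_one_lt_mul_of_half_lt (hq _ ▸ hi), exists_one_lt_mul_of_half_lt ?_⟩
      rw [← hq, cylUnion_append]
      exact hi.trans_le (measureReal_mono subset_union_left)
    · rintro ⟨n, ⟨k, hk⟩, hG'⟩
      by_contra hi
      rw [not_lt, hq] at hi
      exact hi₀ _ (hq _ ▸ (iSup_eq_zero_of_one_lt_two_mul hi hk).1) ⟨⟨k, hk⟩, hG'⟩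
  · push Not at h
    let d : ℕ → List (List 𝒜) := fun n => (Encodable.decode n).getD []
    have hd : Computable d := Computable.option_getD Computable.decode (Computable.const [])
    have hF : Computable fun p : I × ℕ => d p.2 := hd.comp Computable.snd
    have hG : Computable fun p : I × ℕ => d p.2 ++ V' p.1 :=
      Computable.list_append.comp hF (hV'.comp Computable.fst)
    convert sigmaOne_exists_one_lt_mul hqc 1 hF hG using 3 with i
    constructor
    · intro hi
      obtain ⟨W, hW, ⟨k, hk⟩, l, hl⟩ := h i
      refine ⟨Encodable.encode W, ?_⟩
      have hdW : d (Encodable.encode W) = W := by simp [d]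
      simp only [hdW]
      refine ⟨(iSup_eq_zero_of_one_lt_two_mul ?_ hk).2, (iSup_eq_zero_of_one_lt_two_mul ?_ hl).2⟩
      · rw [← hq, hW]; norm_num
      · rw [← hq, hunion W i hW, hadd]; linarith
    · rintro ⟨n, ⟨k, hk⟩, l, hl⟩
      have h1 := iSup_eq_zero_of_one_lt (hle _) hk
      have h2 := iSup_eq_zero_of_one_lt (hle _) hl
      rw [← hq] at h1 h2
      rw [hunion _ i h1, hadd] at h2
      linarith

namespace Computable

variable {α σ : Type*} [Primcodable α] [Primcodable σ]

theorem flatMap_range {f : α → ℕ} {g : α → ℕ → List σ} (hf : Computable f) (hg : Computable₂ g) :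
    Computable fun a => (List.range (f a)).flatMap (g a) := by
  have hstep : Computable₂ fun (a : α) (p : ℕ × List σ) => p.2 ++ g a p.1 :=
    (Primrec.list_append.to_comp.comp (Computable.snd.comp Computable.snd)
      (hg.comp Computable.fst (Computable.fst.comp Computable.snd)))
  refine (Computable.nat_rec hf (Computable.const []) hstep).of_eq fun a => ?_
  induction f a with
  | zero => rfl
  | succ n ih => simp [List.range_succ, ← ih]

theorem map_range {f : α → ℕ} {g : α → ℕ → σ} (hf : Computable f) (hg : Computable₂ g) :
    Computable fun a => (List.range (f a)).map (g a) := by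
  have hg' : Computable₂ fun (a : α) (n : ℕ) => [g a n] :=
    Primrec.list_cons.to_comp.comp hg (Computable.const [])
  exact (flatMap_range hf hg').of_eq fun a => by rw [List.map_eq_flatMap]

theorem list_filter {f : α → List σ} {p : α → σ → Bool} (hf : Computable f) (hp : Computable₂ p) :
    Computable fun a => (f a).filter (p a) := by
  have hsel : Computable₂ fun (q : α × ℕ) (s : σ) => bif p q.1 s then [s] else [] :=
    Computable.cond (hp.comp (Computable.fst.comp Computable.fst) Computable.snd)
      (Primrec.list_cons.to_comp.comp Computable.snd (Computable.const [])) (Computable.const [])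
  have hget : Computable fun q : α × ℕ => (f q.1)[q.2]? :=
    Primrec.list_getElem?.to_comp.comp (hf.comp Computable.fst) Computable.snd
  have hg : Computable₂ fun (a : α) (n : ℕ) =>
      ((f a)[n]?.casesOn [] fun s => bif p a s then [s] else [] : List σ) :=
    Computable.option_casesOn hget (Computable.const []) hsel
  refine (flatMap_range (Computable.list_length.comp hf) hg).of_eq fun a => ?_
  induction f a with
  | nil => rfl
  | cons s l ih =>
    rw [List.length_cons, List.range_succ_eq_map, List.flatMap_cons, List.flatMap_map]
    simp only [List.getElem?_cons_zero, List.getElem?_cons_succ, ih, List.filter_cons]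
    cases p a s <;> rfl

end Computable

section Words

variable {𝒜 : Type}

/-- The prefix of length `m` of a sequence. -/
def seqPrefix (x : ℕ → 𝒜) (m : ℕ) : List 𝒜 := (List.range m).map x

@[simp]
lemma length_seqPrefix (x : ℕ → 𝒜) (m : ℕ) : (seqPrefix x m).length = m := by simp [seqPrefix]

lemma take_seqPrefix (x : ℕ → 𝒜) {m k : ℕ} (h : m ≤ k) :
    (seqPrefix x k).take m = seqPrefix x m := by
  simp [seqPrefix, ← List.map_take, List.take_range, h]

lemma mem_cyl_iff {w : List 𝒜} {x : ℕ → 𝒜} : x ∈ cyl w ↔ seqPrefix x w.length = w := by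
  constructor
  · intro h
    refine List.ext_getElem (by simp) fun i h1 h2 => ?_
    simpa [seqPrefix] using h ⟨i, h2⟩
  · intro h i
    conv_rhs => rw [List.get_eq_getElem, ← List.getElem_of_eq h (by simp)]
    simp [seqPrefix]

/-- An input length sufficient for computing the first `m` letters of the image. -/
def modulus (α : ℕ → ℕ) : ℕ → ℕ
  | 0 => 0
  | m + 1 => modulus α m + α m + 1

lemma le_modulus (α : ℕ → ℕ) (m : ℕ) : m ≤ modulus α m := by
  induction m with
  | zero => exact le_rfl
  | succ m ih => simp only [modulus]; omega

lemma lt_modulus (α : ℕ → ℕ) {j m : ℕ} (h : j < m) : α j < modulus α m := by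
  induction m with
  | zero => omega
  | succ m ih =>
    simp only [modulus]
    rcases Nat.lt_succ_iff_lt_or_eq.1 h with h | rfl
    · have := ih h
      omega
    · omega

/-- The first `m` letters of the image of any extension of the word `u`. -/
def imageWord (α : ℕ → ℕ) (β : ℕ → List 𝒜 → 𝒜) (a₀ : 𝒜) (m : ℕ) (u : List 𝒜) : List 𝒜 :=
  (List.range m).map fun j => β j ((List.range (α j + 1)).map fun i => u.getD i a₀)

/-- Prefix of the `i`-th iterate of any extension of the word `u`, where the prefix lengths are
chosen so that the `n`-th one is `m`. -/
def orbitWord (α : ℕ → ℕ) (β : ℕ → List 𝒜 → 𝒜) (a₀ : 𝒜) (n m : ℕ) (u : List 𝒜) : ℕ → List 𝒜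
  | 0 => u
  | i + 1 => imageWord α β a₀ ((modulus α)^[n - (i + 1)] m) (orbitWord α β a₀ n m u i)

/-- All words of length `L`. -/
noncomputable def wordsOfLength (𝒜 : Type) [Fintype 𝒜] : ℕ → List (List 𝒜)
  | 0 => [[]]
  | L + 1 => (wordsOfLength 𝒜 L).flatMap fun u => Finset.univ.toList.map fun a => u ++ [a]

lemma mem_wordsOfLength [Fintype 𝒜] {L : ℕ} {u : List 𝒜} :
    u ∈ wordsOfLength 𝒜 L ↔ u.length = L := by
  induction L generalizing u with
  | zero => simp [wordsOfLength, List.length_eq_zero_iff]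
  | succ L ih =>
    simp only [wordsOfLength, List.mem_flatMap, ih, List.mem_map, Finset.mem_toList,
      Finset.mem_univ, true_and]
    constructor
    · rintro ⟨v, rfl, a, rfl⟩
      simp
    · intro h
      have hne : u ≠ [] := by rintro rfl; simp at h
      exact ⟨u.dropLast, by simp [h], u.getLast hne, List.dropLast_append_getLast hne⟩

lemma cylUnion_filter_wordsOfLength [Fintype 𝒜] (p : List 𝒜 → Bool) (L : ℕ) :
    cylUnion ((wordsOfLength 𝒜 L).filter p) = {x | p (seqPrefix x L) = true} := by
  ext x
  simp only [cylUnion, List.mem_filter, mem_wordsOfLength, mem_iUnion, exists_prop, mem_cyl_iff]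
  constructor
  · rintro ⟨u, ⟨rfl, h⟩, hx⟩
    change p _ = true
    rwa [hx]
  · intro h
    exact ⟨seqPrefix x L, ⟨by simp, h⟩, by simp⟩

section Correctness

variable {α : ℕ → ℕ} {β : ℕ → List 𝒜 → 𝒜} {T : (ℕ → 𝒜) → (ℕ → 𝒜)} (a₀ : 𝒜)

lemma imageWord_seqPrefix
    (hT : ∀ x n, T x n = β n (List.ofFn fun i : Fin (α n + 1) => x i))
    (x : ℕ → 𝒜) {m k : ℕ} (h : modulus α m ≤ k) :
    imageWord α β a₀ m (seqPrefix x k) = seqPrefix (T x) m := by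
  refine List.map_congr_left fun j hj => ?_
  rw [hT]
  congr 1
  have hk := (lt_modulus α (List.mem_range.1 hj)).trans_le h
  refine List.ext_getElem (by simp) fun i h1 h2 => ?_
  simp only [List.length_map, List.length_range] at h1
  have hi : i < k := by omega
  simp [-List.ofFn_succ, seqPrefix, List.getD_eq_getElem?_getD, hi]

lemma orbitWord_seqPrefix
    (hT : ∀ x n, T x n = β n (List.ofFn fun i : Fin (α n + 1) => x i))
    (x : ℕ → 𝒜) (m : ℕ) {n i : ℕ} (h : i ≤ n) :
    orbitWord α β a₀ n m (seqPrefix x ((modulus α)^[n] m)) i =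
      seqPrefix (T^[i] x) ((modulus α)^[n - i] m) := by
  induction i with
  | zero => rfl
  | succ i ih =>
    rw [orbitWord, ih (by omega), Function.iterate_succ_apply']
    refine imageWord_seqPrefix a₀ hT _ ?_
    rw [← Function.iterate_succ_apply' (modulus α), show (n - (i + 1)).succ = n - i by omega]

end Correctness

/-- The set of points which `ρ` maps letterwise into the cylinder of the image of `w`. -/
def satCyl (ρ : 𝒜 → 𝒜) (w : List 𝒜) : Set (ℕ → 𝒜) := {y | ρ ∘ y ∈ cyl (w.map ρ)}

lemma cyl_subset_satCyl (ρ : 𝒜 → 𝒜) (w : List 𝒜) : cyl w ⊆ satCyl ρ w := by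
  intro x hx i
  have := hx (i.cast (by simp))
  simp only [Fin.val_cast] at this
  simp [this]

open Classical in
/-- Number of times `i < n` at which the orbit of `x` visits the set `C`. -/
noncomputable def visits {X : Type*} (T : X → X) (C : Set X) (n : ℕ) (x : X) : ℕ :=
  ((Finset.range n).filter fun i => T^[i] x ∈ C).card

section Hits

variable [DecidableEq 𝒜]

/-- Number of times `i < n` at which the orbit of any extension of `u` visits the cylinder of `w`,
up to applying the letter map `ρ` to the initial point and to the visited points. -/
def wordHits (α : ℕ → ℕ) (β : ℕ → List 𝒜 → 𝒜) (a₀ : 𝒜) (ρ : 𝒜 → 𝒜) (w : List 𝒜) (n : ℕ)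
    (u : List 𝒜) : ℕ :=
  ((List.range n).filter fun i => decide
    (((orbitWord α β a₀ n w.length (u.map ρ) i).take w.length).map ρ = w.map ρ)).length

lemma wordHits_seqPrefix {α : ℕ → ℕ} {β : ℕ → List 𝒜 → 𝒜} {T : (ℕ → 𝒜) → (ℕ → 𝒜)} (a₀ : 𝒜)
    (hT : ∀ x n, T x n = β n (List.ofFn fun i : Fin (α n + 1) => x i)) (ρ : 𝒜 → 𝒜)
    (w : List 𝒜) (n : ℕ) (x : ℕ → 𝒜) :
    wordHits α β a₀ ρ w n (seqPrefix x ((modulus α)^[n] w.length)) =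
      visits T (satCyl ρ w) n (ρ ∘ x) := by
  classical
  have hcard : visits T (satCyl ρ w) n (ρ ∘ x) =
    ((List.range n).filter fun i => decide (T^[i] (ρ ∘ x) ∈ satCyl ρ w)).length := rfl
  rw [hcard, wordHits]
  congr 1
  refine List.filter_congr fun i hi => decide_eq_decide.2 ?_
  have hmap : ∀ (y : ℕ → 𝒜) k, (seqPrefix y k).map ρ = seqPrefix (ρ ∘ y) k := fun y k => by
    simp [seqPrefix]
  rw [hmap, orbitWord_seqPrefix a₀ hT _ _ (List.mem_range.1 hi).le, take_seqPrefix, hmap,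
    satCyl, mem_ofPred_eq, mem_cyl_iff, List.length_map]
  exact Function.id_le_iterate_of_id_le (le_modulus α) _ _

end Hits

section Computability

variable [Primcodable 𝒜]

lemma computable_modulus {α : ℕ → ℕ} (hα : Computable α) : Computable (modulus α) := by
  have hstep : Computable₂ fun (_ : ℕ) (p : ℕ × ℕ) => p.2 + α p.1 + 1 :=
    Computable.succ.comp (Primrec.nat_add.to_comp.comp (Computable.snd.comp Computable.snd)
      (hα.comp (Computable.fst.comp Computable.snd)))
  refine (Computable.nat_rec Computable.id (Computable.const 0) hstep).of_eq fun m => ?_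
  induction m with
  | zero => rfl
  | succ m ih => exact congrArg (· + α m + 1) ih

lemma computable_iterate_modulus {α : ℕ → ℕ} (hα : Computable α) :
    Computable₂ fun n m : ℕ => (modulus α)^[n] m := by
  have hstep : Computable₂ fun (_ : ℕ × ℕ) (p : ℕ × ℕ) => modulus α p.2 :=
    (computable_modulus hα).comp (Computable.snd.comp Computable.snd)
  refine (Computable.nat_rec Computable.fst Computable.snd hstep).of_eq fun p => ?_
  obtain ⟨n, m⟩ := p
  induction n with
  | zero => rfl
  | succ n ih =>
    exact (congrArg (modulus α) ih).trans (Function.iterate_succ_apply' _ _ _).symm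

lemma computable_imageWord {α : ℕ → ℕ} {β : ℕ → List 𝒜 → 𝒜} (hα : Computable α)
    (hβ : Computable₂ β) (a₀ : 𝒜) : Computable₂ (imageWord α β a₀) := by
  have hletter : Computable₂ fun (p : (ℕ × List 𝒜) × ℕ) (i : ℕ) => p.1.2.getD i a₀ :=
    (Primrec.list_getD a₀).to_comp.comp
      (Computable.snd.comp (Computable.fst.comp Computable.fst)) Computable.snd
  have hlist : Computable fun p : (ℕ × List 𝒜) × ℕ =>
      (List.range (α p.2 + 1)).map fun i => p.1.2.getD i a₀ :=
    Computable.map_range (Computable.succ.comp (hα.comp Computable.snd)) hletter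
  have hβ' : Computable₂ fun (p : ℕ × List 𝒜) (j : ℕ) =>
      β j ((List.range (α j + 1)).map fun i => p.2.getD i a₀) := hβ.comp Computable.snd hlist
  exact Computable.map_range Computable.fst hβ'

lemma computable_orbitWord {α : ℕ → ℕ} {β : ℕ → List 𝒜 → 𝒜} (hα : Computable α)
    (hβ : Computable₂ β) (a₀ : 𝒜) : Computable fun p : ((ℕ × ℕ) × List 𝒜) × ℕ =>
      orbitWord α β a₀ p.1.1.1 p.1.1.2 p.1.2 p.2 := by
  have hlen : Computable fun p : (((ℕ × ℕ) × List 𝒜) × ℕ) × (ℕ × List 𝒜) =>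
      (modulus α)^[p.1.1.1.1 - (p.2.1 + 1)] p.1.1.1.2 :=
    have h : Computable fun p : (((ℕ × ℕ) × List 𝒜) × ℕ) × (ℕ × List 𝒜) => p.1.1.1 :=
      Computable.fst.comp (Computable.fst.comp Computable.fst)
    (computable_iterate_modulus hα).comp
      (Primrec.nat_sub.to_comp.comp (Computable.fst.comp h)
        (Computable.succ.comp (Computable.fst.comp Computable.snd))) (Computable.snd.comp h)
  have hstep : Computable₂ fun (p : ((ℕ × ℕ) × List 𝒜) × ℕ) (r : ℕ × List 𝒜) =>
      imageWord α β a₀ ((modulus α)^[p.1.1.1 - (r.1 + 1)] p.1.1.2) r.2 :=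
    (computable_imageWord hα hβ a₀).comp hlen (Computable.snd.comp Computable.snd)
  refine (Computable.nat_rec Computable.snd (Computable.snd.comp Computable.fst) hstep).of_eq
    fun p => ?_
  obtain ⟨p, i⟩ := p
  induction i with
  | zero => rfl
  | succ i ih => exact congrArg (imageWord α β a₀ _) ih

lemma primrec_wordsOfLength [Fintype 𝒜] : Primrec (wordsOfLength 𝒜) := by
  have happ : Primrec₂ fun (u : List 𝒜) (a : 𝒜) => u ++ [a] := Primrec.list_concat
  have hmap : Primrec fun u : List 𝒜 => (Finset.univ.toList : List 𝒜).map fun a => u ++ [a] :=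
    Primrec.list_map (Primrec.const _) happ
  have hstep : Primrec₂ fun (_ : ℕ) (W : List (List 𝒜)) =>
      W.flatMap fun u => Finset.univ.toList.map fun a => u ++ [a] :=
    Primrec.list_flatMap Primrec.snd (hmap.comp Primrec.snd).to₂
  refine (Primrec.nat_rec₁ [[]] hstep).of_eq fun L => ?_
  induction L with
  | zero => rfl
  | succ L ih => simp only [wordsOfLength, ← ih]

lemma computable_wordHits [Finite 𝒜] [DecidableEq 𝒜] {α : ℕ → ℕ} {β : ℕ → List 𝒜 → 𝒜}
    (hα : Computable α) (hβ : Computable₂ β) (a₀ : 𝒜) (ρ : 𝒜 → 𝒜) :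
    Computable fun p : (List 𝒜 × ℕ) × List 𝒜 => wordHits α β a₀ ρ p.1.1 p.1.2 p.2 := by
  have hρ : Primrec fun u : List 𝒜 => u.map ρ :=
    Primrec.list_map Primrec.id ((Primrec.dom_finite ρ).comp Primrec.snd).to₂
  have hw : Computable fun p : ((List 𝒜 × ℕ) × List 𝒜) × ℕ => p.1.1.1 :=
    Computable.fst.comp (Computable.fst.comp Computable.fst)
  have hlen : Computable fun p : ((List 𝒜 × ℕ) × List 𝒜) × ℕ => p.1.1.1.length :=
    Computable.list_length.comp hw
  have hn : Computable fun p : ((List 𝒜 × ℕ) × List 𝒜) × ℕ => p.1.1.2 :=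
    Computable.snd.comp (Computable.fst.comp Computable.fst)
  have hu : Computable fun p : ((List 𝒜 × ℕ) × List 𝒜) × ℕ => p.1.2.map ρ :=
    hρ.to_comp.comp (Computable.snd.comp Computable.fst)
  have harg : Computable fun p : ((List 𝒜 × ℕ) × List 𝒜) × ℕ =>
      (((p.1.1.2, p.1.1.1.length), p.1.2.map ρ), p.2) :=
    ((hn.pair hlen).pair hu).pair Computable.snd
  have horb : Computable fun p : ((List 𝒜 × ℕ) × List 𝒜) × ℕ =>
      orbitWord α β a₀ p.1.1.2 p.1.1.1.length (p.1.2.map ρ) p.2 :=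
    by have h := (computable_orbitWord hα hβ a₀).comp harg; exact h
  have heq : Computable₂ fun u v : List 𝒜 => decide (u = v) := Primrec.eq.decide.to_comp
  have hleft : Computable fun p : ((List 𝒜 × ℕ) × List 𝒜) × ℕ =>
      ((orbitWord α β a₀ p.1.1.2 p.1.1.1.length (p.1.2.map ρ) p.2).take p.1.1.1.length).map ρ :=
    hρ.to_comp.comp (Primrec.list_take.to_comp.comp hlen horb)
  have hright : Computable fun p : ((List 𝒜 × ℕ) × List 𝒜) × ℕ => p.1.1.1.map ρ :=
    hρ.to_comp.comp hw
  have htest : Computable₂ fun (p : (List 𝒜 × ℕ) × List 𝒜) (i : ℕ) => decide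
      (((orbitWord α β a₀ p.1.2 p.1.1.length (p.2.map ρ) i).take p.1.1.length).map ρ =
        p.1.1.map ρ) := heq.comp hleft hright
  have hrange : Computable fun p : (List 𝒜 × ℕ) × List 𝒜 => List.range p.1.2 :=
    Primrec.list_range.to_comp.comp (Computable.snd.comp Computable.fst)
  exact Computable.list_length.comp (Computable.list_filter hrange htest)

end Computability

end Words

section LetterRetraction

/-- Letters can be collapsed to representatives of the atoms of the measurable structure. -/
lemma exists_letter_retraction (𝒜 : Type*) [Countable 𝒜] [MeasurableSpace 𝒜] :
    ∃ ρ : 𝒜 → 𝒜, (∀ s, MeasurableSet s → ρ ⁻¹' s = s) ∧ ∀ s, MeasurableSet (ρ ⁻¹' s) := by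
  have hne : ∀ a : 𝒜, (measurableAtom a).Nonempty := fun a => ⟨a, mem_measurableAtom_self a⟩
  have hmem : ∀ a, (hne a).some ∈ measurableAtom a := fun a => (hne a).some_mem
  have hcongr : ∀ a b, b ∈ measurableAtom a → (hne b).some = (hne a).some := by
    intro a b hb
    congr 1
    exact measurableAtom_eq_of_mem hb
  refine ⟨fun a => (hne a).some, fun s hs => ?_, fun s => ?_⟩
  · ext a
    refine ⟨fun h => ?_, fun h => measurableAtom_subset hs h (hmem a)⟩
    have h1 := measurableAtom_subset hs h
    rw [measurableAtom_eq_of_mem (hmem a)] at h1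
    exact h1 (mem_measurableAtom_self a)
  · set t := (fun a => (hne a).some) ⁻¹' s with ht
    have : t = ⋃ a ∈ t, measurableAtom a := by
      ext b
      simp only [mem_iUnion, exists_prop]
      refine ⟨fun h => ⟨b, h, mem_measurableAtom_self b⟩, ?_⟩
      rintro ⟨a, ha, hb⟩
      change (hne b).some ∈ s
      rw [hcongr a b hb]
      exact ha
    rw [this]
    exact MeasurableSet.biUnion (to_countable _) fun a _ =>
      MeasurableSet.measurableAtom_of_countable a

variable {𝒜 : Type*} [MeasurableSpace 𝒜] {ρ : 𝒜 → 𝒜}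

lemma preimage_comp_eq_of_measurableSet (hρ : ∀ s, MeasurableSet s → ρ ⁻¹' s = s)
    {E : Set (ℕ → 𝒜)} (hE : MeasurableSet E) : (fun x => ρ ∘ x) ⁻¹' E = E := by
  have hle : (MeasurableSpace.pi : MeasurableSpace (ℕ → 𝒜)) ≤
      MeasurableSpace.invariants fun x => ρ ∘ x := by
    refine iSup_le fun i => ?_
    rintro - ⟨s, hs, rfl⟩
    refine MeasurableSpace.measurableSet_invariants.2 ⟨measurable_pi_apply i hs, ?_⟩
    change (fun x : ℕ → 𝒜 => x i) ⁻¹' (ρ ⁻¹' s) = _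
    rw [hρ s hs]
  exact (MeasurableSpace.measurableSet_invariants.1 (hle E hE)).2

lemma ae_comp_of_ae (hρ : ∀ s, MeasurableSet s → ρ ⁻¹' s = s) {μ : Measure (ℕ → 𝒜)}
    {p : (ℕ → 𝒜) → Prop} (h : ∀ᵐ x ∂μ, p x) : ∀ᵐ x ∂μ, p (ρ ∘ x) := by
  obtain ⟨E, hpE, hE, hE0⟩ := exists_measurable_superset_of_null (ae_iff.1 h)
  refine ae_iff.2 (measure_mono_null (fun x hx => ?_) hE0)
  rw [← preimage_comp_eq_of_measurableSet hρ hE]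
  exact hpE hx

lemma measurableSet_comp_mem_of_isOpen [Countable 𝒜] [TopologicalSpace 𝒜] [DiscreteTopology 𝒜]
    (hρ : ∀ s, MeasurableSet (ρ ⁻¹' s)) {K : Set (ℕ → 𝒜)} (hK : IsOpen K) :
    MeasurableSet {x | ρ ∘ x ∈ K} := by
  have hKm : MeasurableSet[@MeasurableSpace.pi ℕ (fun _ => 𝒜) fun _ => ⊤] K := by
    let _ : MeasurableSpace 𝒜 := ⊤
    exact hK.measurableSet
  have hmeas : @Measurable (ℕ → 𝒜) (ℕ → 𝒜) MeasurableSpace.pi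
      (@MeasurableSpace.pi ℕ (fun _ => 𝒜) fun _ => ⊤) fun x => ρ ∘ x := by
    refine @measurable_pi_lambda _ _ _ _ (fun _ => ⊤) _ fun i => ?_
    exact @Measurable.comp _ _ _ _ _ ⊤ ρ _ (fun s _ => hρ s)
      (measurable_pi_apply i)
  exact hmeas hKm

end LetterRetraction

section Topology

variable {𝒜 : Type*} [TopologicalSpace 𝒜] [DiscreteTopology 𝒜]

lemma isClopen_cyl (w : List 𝒜) : IsClopen (cyl w) := by
  have : cyl w = ⋂ i : Fin w.length, {x | x i = w.get i} := by
    ext x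
    simp [cyl]
  rw [this]
  exact isClopen_iInter_of_finite fun i =>
    (isClopen_discrete {w.get i}).preimage (continuous_apply (i : ℕ))

lemma continuous_letterwise (ρ : 𝒜 → 𝒜) : Continuous fun x : ℕ → 𝒜 => ρ ∘ x :=
  continuous_pi fun i => continuous_of_discreteTopology.comp (continuous_apply i)

lemma continuous_of_prefix_modulus {α : ℕ → ℕ} {β : ℕ → List 𝒜 → 𝒜} {T : (ℕ → 𝒜) → (ℕ → 𝒜)}
    (hT : ∀ x n, T x n = β n (List.ofFn fun i : Fin (α n + 1) => x i)) : Continuous T := by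
  refine continuous_pi fun n => ?_
  have hpre : Continuous fun (x : ℕ → 𝒜) (i : Fin (α n + 1)) => x i :=
    continuous_pi fun i => continuous_apply (i : ℕ)
  have hout : Continuous fun u : Fin (α n + 1) → 𝒜 => β n (List.ofFn u) :=
    continuous_of_discreteTopology
  exact (hout.comp hpre).congr fun x => (hT x n).symm

lemma isClopen_satCyl {𝒜 : Type} [TopologicalSpace 𝒜] [DiscreteTopology 𝒜] (ρ : 𝒜 → 𝒜)
    (w : List 𝒜) : IsClopen (satCyl ρ w) :=
  (isClopen_cyl (w.map ρ)).preimage (continuous_letterwise ρ)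

end Topology

section Frequencies

variable {𝒜 : Type} [MeasurableSpace 𝒜]

/-- A cylinder and its saturation have the same (outer) measure. -/
lemma measure_satCyl_le {ρ : 𝒜 → 𝒜} (hρ : ∀ s, MeasurableSet s → ρ ⁻¹' s = s)
    (μ : Measure (ℕ → 𝒜)) (w : List 𝒜) : μ (satCyl ρ w) ≤ μ (cyl w) := by
  rw [← measure_toMeasurable (cyl w)]
  refine measure_mono fun y hy => ?_
  set x : ℕ → 𝒜 := fun i => w.getD i (y i) with hx
  have hxw : x ∈ cyl w := fun i => by simp [hx]
  have hcomp : ρ ∘ x = ρ ∘ y := by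
    funext i
    by_cases hi : i < w.length
    · have := hy ⟨i, by simpa using hi⟩
      simp only [Function.comp_apply, List.get_eq_getElem, List.getElem_map] at this
      simp [hx, hi, this]
    · simp [hx, hi]
  have hinv := preimage_comp_eq_of_measurableSet hρ (measurableSet_toMeasurable μ (cyl w))
  rw [← hinv]
  change ρ ∘ y ∈ toMeasurable μ (cyl w)
  rw [← hcomp]
  have hxm := subset_toMeasurable μ (cyl w) hxw
  rwa [← hinv] at hxm

variable [TopologicalSpace 𝒜] [DiscreteTopology 𝒜]

lemma cyl_inter_measSupport_nonempty_iff [Countable 𝒜] {ρ : 𝒜 → 𝒜}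
    (hρ : ∀ s, MeasurableSet s → ρ ⁻¹' s = s) (μ : Measure (ℕ → 𝒜)) [IsFiniteMeasure μ]
    (w : List 𝒜) : (cyl w ∩ measSupport μ).Nonempty ↔ 0 < μ.real (satCyl ρ w) := by
  rw [measureReal_def, ENNReal.toReal_pos_iff]
  constructor
  · rintro ⟨x, hxw, hx⟩
    exact ⟨(hx _ (isClopen_cyl w).isOpen hxw).trans_le (measure_mono (cyl_subset_satCyl ρ w)),
      measure_lt_top _ _⟩
  · rintro ⟨hpos, -⟩
    by_contra hemp
    refine (hpos.trans_le (measure_satCyl_le hρ μ w)).ne' (measure_null_of_locally_null _ ?_)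
    intro x hx
    have hx' : x ∉ measSupport μ := fun h => hemp ⟨x, hx, h⟩
    simp only [measSupport, mem_ofPred_eq, not_forall, not_lt, nonpos_iff_eq_zero] at hx'
    obtain ⟨U, hU, hxU, hU0⟩ := hx'
    exact ⟨U, mem_nhdsWithin_of_mem_nhds (hU.mem_nhds hxU), hU0⟩

lemma measureReal_empMeasure {X : Type*} [MeasurableSpace X] (T : X → X) {C : Set X}
    (hC : MeasurableSet C) (x : X) (n : ℕ) :
    (empMeasure T x n).real C = visits T C n x / n := by
  classical
  have hsum : ∑ i ∈ Finset.range n, C.indicator (1 : X → ℝ≥0∞) (T^[i] x) = visits T C n x := by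
    simp [visits, Set.indicator_apply, Finset.sum_boole]
  simp only [measureReal_def, empMeasure, Measure.smul_apply, Measure.finsetSum_apply,
    Measure.dirac_apply' _ hC, hsum, smul_eq_mul, ENNReal.toReal_mul, ENNReal.toReal_inv,
    ENNReal.toReal_natCast]
  ring

lemma tendsto_visits_div {X : Type*} [TopologicalSpace X] [MeasurableSpace X] {T : X → X}
    {μ : Measure X} {x : X} (h : WeakTendsto (empMeasure T x) μ) {C : Set X} (hC : IsClopen C)
    (hCm : MeasurableSet C) :
    Tendsto (fun n : ℕ => (visits T C n x : ℝ) / n) atTop (𝓝 (μ.real C)) := by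
  have := h ⟨C.indicator 1, hC.continuous_indicator continuous_one⟩
  simpa [integral_indicator_one hCm, measureReal_empMeasure T hCm] using this

variable [Countable 𝒜]

lemma measurable_visits_comp {ρ : 𝒜 → 𝒜} (hρ : ∀ s, MeasurableSet (ρ ⁻¹' s))
    {T : (ℕ → 𝒜) → (ℕ → 𝒜)} (hT : Continuous T) {C : Set (ℕ → 𝒜)} (hC : IsOpen C) (n : ℕ) :
    Measurable fun x => visits T C n (ρ ∘ x) := by
  classical
  simp only [visits, Finset.card_filter]
  exact Finset.measurable_sum _ fun i _ => Measurable.ite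
    (measurableSet_comp_mem_of_isOpen hρ (hC.preimage (hT.iterate i))) measurable_const
    measurable_const

end Frequencies

lemma limit_frequency_pos_iff {Ω : Type*} [MeasurableSpace Ω] {P : Measure Ω}
    [IsProbabilityMeasure P] {N : ℕ → Ω → ℕ} (hN : ∀ n, Measurable (N n)) {m : ℝ} (hm : 0 ≤ m)
    (hlim : ∀ᵐ x ∂P, Tendsto (fun n : ℕ => (N n x : ℝ) / n) atTop (𝓝 m)) :
    0 < m ↔ ∃ c n₀ : ℕ, ∀ n, n₀ ≤ n → ¬ 1 / 2 < P.real {x | (c + 1) * N n x ≤ n} := by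
  have hmeas : ∀ n : ℕ, Measurable fun x => (N n x : ℝ) / n := fun n =>
    (measurable_from_nat.comp (hN n)).div_const _
  have hprob := tendstoInMeasure_iff_measureReal_dist.1 <| tendstoInMeasure_of_tendsto_ae
    (fun n => (hmeas n).aestronglyMeasurable) hlim
  constructor
  · intro hpos
    obtain ⟨c, hc⟩ := exists_nat_one_div_lt (half_pos hpos)
    obtain ⟨n₀, hn₀⟩ := eventually_atTop.1 <|
      ((hprob (m / 2) (half_pos hpos)).eventually_lt_const one_half_pos).and (eventually_ge_atTop 1)
    refine ⟨c, n₀, fun n hn =>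
      not_lt.2 (le_trans (measureReal_mono fun x hx => ?_) (hn₀ n hn).1.le)⟩
    have hn1 : (0 : ℝ) < n := by exact_mod_cast (hn₀ n hn).2
    have hx' : ((c : ℝ) + 1) * N n x ≤ n := by exact_mod_cast hx
    have hle : (N n x : ℝ) / n ≤ 1 / (c + 1) := by
      rw [div_le_div_iff₀ hn1 (by positivity)]
      linarith
    change m / 2 ≤ dist ((N n x : ℝ) / n) m
    rw [dist_comm, Real.dist_eq]
    exact le_trans (by linarith) (le_abs_self _)
  · rintro ⟨c, n₀, h⟩
    refine hm.lt_of_ne fun h0 => ?_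
    subst h0
    have hc : (0 : ℝ) < 1 / (c + 1) := by positivity
    obtain ⟨n, hn, hnn₀, hn1⟩ := ((hprob _ hc).eventually_lt_const one_half_pos |>.and
      ((eventually_ge_atTop n₀).and (eventually_ge_atTop 1))).exists
    refine h n hnn₀ ?_
    have hset : MeasurableSet {x | (c + 1) * N n x ≤ n} :=
      measurableSet_le ((hN n).const_mul _) measurable_const
    have hcompl : P.real {x | (c + 1) * N n x ≤ n}ᶜ < 1 / 2 := by
      refine lt_of_le_of_lt (measureReal_mono fun x hx => ?_) hn
      have hn1 : (0 : ℝ) < n := by exact_mod_cast hn1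
      have hx' : (n : ℝ) < (c + 1) * N n x := by
        exact_mod_cast not_le.1 (show ¬ (c + 1) * N n x ≤ n from hx)
      change _ ≤ dist ((N n x : ℝ) / n) 0
      rw [Real.dist_eq, sub_zero]
      refine le_trans ?_ (le_abs_self _)
      rw [div_le_div_iff₀ (by positivity) hn1]
      linarith
    rw [probReal_compl_eq_one_sub hset] at hcompl
    linarith

lemma sigmaTwo_of_sigmaOne {I : Type*} [Primcodable I] {S : Set I} {R : Set (I × ℕ × ℕ)}
    (hR : SigmaOne R) (h : ∀ i, i ∈ S ↔ ∃ c n₀ : ℕ, ∀ n, n₀ ≤ n → (i, c, n) ∉ R) :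
    SigmaTwo S := by
  obtain ⟨f, hf, hfR⟩ := hR
  have hunpair : Computable Nat.unpair := Primrec.unpair.to_comp
  have ha : Computable fun p : I × ℕ × ℕ => p.2.1.unpair :=
    hunpair.comp (Computable.fst.comp Computable.snd)
  have hb : Computable fun p : I × ℕ × ℕ => p.2.2.unpair :=
    hunpair.comp (Computable.snd.comp Computable.snd)
  have harg : Computable fun p : I × ℕ × ℕ =>
      ((p.1, p.2.1.unpair.1, p.2.2.unpair.1), p.2.2.unpair.2) :=
    (Computable.fst.pair ((Computable.fst.comp ha).pair (Computable.fst.comp hb))).pair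
      (Computable.snd.comp hb)
  have hlt : Computable₂ fun k l : ℕ => decide (k < l) := Primrec.nat_lt.decide.to_comp
  have hltarg : Computable fun p : I × ℕ × ℕ => decide (p.2.2.unpair.1 < p.2.1.unpair.2) :=
    hlt.comp (Computable.fst.comp hb) (Computable.snd.comp ha)
  have hor : Computable₂ or := Primrec.or.to_comp
  have hnot : Computable not := Primrec.not.to_comp
  refine ⟨_, hor.comp hltarg (hnot.comp (hf.comp harg)), fun i => ?_⟩
  rw [h]
  constructor
  · rintro ⟨c, n₀, hc⟩
    refine ⟨Nat.pair c n₀, fun b => ?_⟩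
    simp only [Nat.unpair_pair, Bool.or_eq_true, decide_eq_true_eq, Bool.not_eq_true']
    refine or_iff_not_imp_left.2 fun hb => ?_
    by_contra hfb
    exact hc _ (not_lt.1 hb) ((hfR _).2 ⟨_, by simpa using hfb⟩)
  · rintro ⟨a, ha⟩
    refine ⟨a.unpair.1, a.unpair.2, fun n hn hR => ?_⟩
    obtain ⟨k, hk⟩ := (hfR _).1 hR
    exact hn.not_gt (by simpa [hk] using ha (Nat.pair n k))

lemma computable_decide_mul_wordHits_le {𝒜 : Type} [Primcodable 𝒜] [Finite 𝒜] [DecidableEq 𝒜]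
    {α : ℕ → ℕ} {β : ℕ → List 𝒜 → 𝒜} (hα : Computable α) (hβ : Computable₂ β) (a₀ : 𝒜)
    (ρ : 𝒜 → 𝒜) : Computable₂ fun (i : List 𝒜 × ℕ × ℕ) (u : List 𝒜) =>
      decide ((i.2.1 + 1) * wordHits α β a₀ ρ i.1 i.2.2 u ≤ i.2.2) := by
  have hc : Computable fun p : (List 𝒜 × ℕ × ℕ) × List 𝒜 => p.1.2.1 + 1 :=
    Computable.succ.comp (Computable.fst.comp (Computable.snd.comp Computable.fst))
  have hn : Computable fun p : (List 𝒜 × ℕ × ℕ) × List 𝒜 => p.1.2.2 :=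
    Computable.snd.comp (Computable.snd.comp Computable.fst)
  have harg : Computable fun p : (List 𝒜 × ℕ × ℕ) × List 𝒜 => ((p.1.1, p.1.2.2), p.2) :=
    ((Computable.fst.comp Computable.fst).pair hn).pair Computable.snd
  have hhits := (computable_wordHits hα hβ a₀ ρ).comp harg
  have hmul : Computable₂ fun k l : ℕ => k * l := Primrec.nat_mul.to_comp
  have hle : Computable₂ fun k l : ℕ => decide (k ≤ l) := Primrec.nat_le.decide.to_comp
  have hprod := hmul.comp hc hhits
  have h := hle.comp hprod hn
  exact h

lemma computable_wordsOfLength_iterate_modulus {𝒜 : Type} [Primcodable 𝒜] [Fintype 𝒜]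
    {α : ℕ → ℕ} (hα : Computable α) : Computable fun i : List 𝒜 × ℕ × ℕ =>
      wordsOfLength 𝒜 ((modulus α)^[i.2.2] i.1.length) := by
  have hn : Computable fun i : List 𝒜 × ℕ × ℕ => i.2.2 := Computable.snd.comp Computable.snd
  have hlen : Computable fun i : List 𝒜 × ℕ × ℕ => i.1.length :=
    Computable.list_length.comp Computable.fst
  have h := (computable_iterate_modulus hα).comp hn hlen
  exact primrec_wordsOfLength.to_comp.comp h

/-- A statistical attractor of a computable map of Cantor space w.r.t. a computable Borel
probability measure is a Σ₂ closed set: its inner collection of cylinders is Σ₂. -/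
theorem stmt7 {𝒜 : Type} [Fintype 𝒜] [Primcodable 𝒜]
    [TopologicalSpace 𝒜] [DiscreteTopology 𝒜] [MeasurableSpace 𝒜]
    {T : (ℕ → 𝒜) → (ℕ → 𝒜)} (hT : CantorComputable T)
    (lam : Measure (ℕ → 𝒜)) [IsProbabilityMeasure lam]
    (hlam : ComputableCantorMeasure lam)
    {A : Set (ℕ → 𝒜)} (hA : IsStatAttractor T lam A) :
    SigmaTwo {w : List 𝒜 | (cyl w ∩ A).Nonempty} := by
  classical
  obtain ⟨α, β, hα, hβ, hTβ⟩ := hT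
  obtain ⟨-, μ, hμ, -, rfl, hconv⟩ := hA
  obtain ⟨ρ, hρ, hρm⟩ := exists_letter_retraction 𝒜
  have a₀ : 𝒜 := (lam.nonempty_of_neZero).some 0
  have hTc : Continuous T := continuous_of_prefix_modulus hTβ
  have hC : ∀ w, IsClopen (satCyl ρ w) := isClopen_satCyl ρ
  have hCm : ∀ w, MeasurableSet (satCyl ρ w) := fun w =>
    measurableSet_comp_mem_of_isOpen hρm (isClopen_cyl (w.map ρ)).isOpen
  have hvisits : ∀ w n, Measurable fun x => visits T (satCyl ρ w) n (ρ ∘ x) := fun w n =>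
    measurable_visits_comp hρm hTc (hC w).isOpen n
  have hlim : ∀ w, ∀ᵐ x ∂lam, Tendsto
      (fun n : ℕ => (visits T (satCyl ρ w) n (ρ ∘ x) : ℝ) / n) atTop
      (𝓝 (μ.real (satCyl ρ w))) := fun w =>
    (ae_comp_of_ae hρ hconv).mono fun x hx => tendsto_visits_div hx (hC w) (hCm w)
  let few : List 𝒜 × ℕ × ℕ → List 𝒜 → Bool := fun i u =>
    decide ((i.2.1 + 1) * wordHits α β a₀ ρ i.1 i.2.2 u ≤ i.2.2)
  let words : List 𝒜 × ℕ × ℕ → List (List 𝒜) := fun i =>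
    wordsOfLength 𝒜 ((modulus α)^[i.2.2] i.1.length)
  have hfew : Computable₂ few := computable_decide_mul_wordHits_le hα hβ a₀ ρ
  have hwords : Computable words := computable_wordsOfLength_iterate_modulus hα
  have hunion : ∀ i, cylUnion ((words i).filter (few i)) =
      {x | (i.2.1 + 1) * visits T (satCyl ρ i.1) i.2.2 (ρ ∘ x) ≤ i.2.2} := fun i => by
    rw [cylUnion_filter_wordsOfLength]
    ext x
    simp only [few, mem_ofPred_eq, decide_eq_true_eq, wordHits_seqPrefix a₀ hTβ]
  have hmany : Computable₂ fun i u => !few i u := by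
    have hnot : Computable not := Primrec.not.to_comp
    exact hnot.comp hfew
  have hV : Computable fun i => (words i).filter (few i) := Computable.list_filter hwords hfew
  have hV' : Computable fun i => (words i).filter fun u => !few i u :=
    Computable.list_filter hwords hmany
  have hmeas : ∀ i, MeasurableSet (cylUnion ((words i).filter (few i))) := fun i => by
    rw [hunion]
    exact measurableSet_le ((hvisits _ _).const_mul _) measurable_const
  have hcompl : ∀ i, cylUnion ((words i).filter fun u => !few i u) =
      (cylUnion ((words i).filter (few i)))ᶜ := fun i => by
    simp only [words, cylUnion_filter_wordsOfLength]
    ext x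
    simp
  have hsigma := sigmaOne_half_lt_measure hlam hV hV' hmeas hcompl
  refine sigmaTwo_of_sigmaOne hsigma fun w => ?_
  change (cyl w ∩ measSupport μ).Nonempty ↔ _
  rw [cyl_inter_measSupport_nonempty_iff hρ, limit_frequency_pos_iff (hvisits w) measureReal_nonneg
    (hlim w)]
  simp only [mem_ofPred_eq, hunion]
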